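/- arXiv:1107.1794 — 2 statements merged into one kernel-verified Lean document; each statement's English description precedes it below -/
import Mathlib

section
/- The fold product of copulas is associative: for 2-copulas C₁, C₂, C₃, one has (C₁ ∗ C₂) ∗ C₃ = C₁ ∗ (C₂ ∗ C₃). -/
open MeasureTheory ProbabilityTheory Set Filter

/-- A 2-copula on `[0,1]²`. -/
def IsCopula (C : ℝ → ℝ → ℝ) : Prop :=
  (∀ x ∈ Icc (0:ℝ) 1, C x 0 = 0) ∧
  (∀ y ∈ Icc (0:ℝ) 1, C 0 y = 0) ∧
  (∀ x ∈ Icc (0:ℝ) 1, C x 1 = x) ∧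
  (∀ y ∈ Icc (0:ℝ) 1, C 1 y = y) ∧
  (∀ x₁ x₂ y₁ y₂ : ℝ, x₁ ∈ Icc (0:ℝ) 1 → x₂ ∈ Icc (0:ℝ) 1 → y₁ ∈ Icc (0:ℝ) 1 →
    y₂ ∈ Icc (0:ℝ) 1 → x₁ ≤ x₂ → y₁ ≤ y₂ →
    0 ≤ C x₂ y₂ - C x₂ y₁ - C x₁ y₂ + C x₁ y₁)

/-- The fold product of two copulas:
`(C₁ ∗ C₂)(x,y) = ∫₀¹ ∂₂C₁(x,t) ∂₁C₂(t,y) dt`. -/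
noncomputable def foldProd (C₁ C₂ : ℝ → ℝ → ℝ) : ℝ → ℝ → ℝ := fun x y =>
  ∫ t in (0:ℝ)..1, deriv (fun s => C₁ x s) t * deriv (fun s => C₂ s y) t

/-- Lebesgue measure on the open unit interval. -/
noncomputable abbrev uM : Measure ℝ := volume.restrict (Ioo (0:ℝ) 1)

/-- A bounded linear functional on integrable functions vanishing on half-line indicators is zero. -/
lemma zero_of_steps (d : (ℝ → ℝ) → ℝ) (K : ℝ)
    (hadd : ∀ f g, Integrable f uM → Integrable g uM → d (f + g) = d f + d g)
    (hsmul : ∀ (c : ℝ) f, Integrable f uM → d (c • f) = c * d f)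
    (hb : ∀ f, Integrable f uM → |d f| ≤ K * ∫ t, |f t| ∂uM)
    (h0 : ∀ a : ℝ, d ((Iic a).indicator (fun _ => (1:ℝ))) = 0) :
    ∀ f, Integrable f uM → d f = 0 := by
  have hzero : d 0 = 0 := by
    have := hsmul 0 0 (integrable_zero _ _ _)
    simpa using this
  have hint : ∀ s : Set ℝ, MeasurableSet s → Integrable (s.indicator (fun _ => (1:ℝ))) uM :=
    fun s hs => (integrable_const (1:ℝ)).indicator hs
  have hsub : ∀ f g, Integrable f uM → Integrable g uM → d (f - g) = d f - d g := by
    intro f g hf hg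
    have h1 := hadd (f - g) g (hf.sub hg) hg
    rw [sub_add_cancel] at h1
    linarith
  have hae : ∀ f g, Integrable f uM → f =ᵐ[uM] g → d f = d g := by
    intro f g hf hfg
    have hg : Integrable g uM := hf.congr hfg
    have h1 := hb (f - g) (hf.sub hg)
    have h2 : ∫ t, |(f - g) t| ∂uM = 0 := by
      rw [integral_eq_zero_iff_of_nonneg (fun t => abs_nonneg _) (hf.sub hg).abs]
      filter_upwards [hfg] with t ht
      simp [ht]
    rw [h2, mul_zero, hsub f g hf hg] at h1
    linarith [abs_nonpos_iff.1 h1]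
  have hset : ∀ s : Set ℝ, MeasurableSet s → d (s.indicator (fun _ => (1:ℝ))) = 0 := by
    intro s hs
    induction s, hs using MeasurableSpace.induction_on_inter
      (borel_eq_generateFrom_Iic ℝ) isPiSystem_Iic with
    | empty =>
      rw [indicator_empty]
      exact hzero
    | basic t ht =>
      obtain ⟨q, rfl⟩ := ht
      exact h0 q
    | compl t ht iht =>
      have h1 : d ((univ : Set ℝ).indicator (fun _ => (1:ℝ))) = 0 := by
        rw [← h0 1]
        apply hae _ _ (hint _ MeasurableSet.univ)
        filter_upwards [ae_restrict_mem measurableSet_Ioo] with t ht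
        simp [ht.2.le]
      have h2 : tᶜ.indicator (fun _ => (1:ℝ)) =
          (univ : Set ℝ).indicator (fun _ => (1:ℝ)) - t.indicator (fun _ => (1:ℝ)) := by
        rw [indicator_compl]; simp
      rw [h2, hsub _ _ (hint _ MeasurableSet.univ) (hint _ ht), h1, iht, sub_zero]
    | iUnion s hd hm ih =>
      have hpart : ∀ n, d ((⋃ i ∈ Finset.range n, s i).indicator (fun _ => (1:ℝ))) = 0 := by
        intro n
        induction n with
        | zero =>
          simp only [Finset.range_zero, Finset.notMem_empty, iUnion_of_empty, iUnion_empty,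
            indicator_empty]
          exact hzero
        | succ n ihn =>
          have hdisj : Disjoint (s n) (⋃ i ∈ Finset.range n, s i) := by
            simp only [disjoint_iUnion_right]
            intro i hi
            exact hd (by have := Finset.mem_range.1 hi; omega)
          have : (⋃ i ∈ Finset.range (n+1), s i).indicator (fun _ => (1:ℝ)) =
              (s n).indicator (fun _ => (1:ℝ)) +
              (⋃ i ∈ Finset.range n, s i).indicator (fun _ => (1:ℝ)) := by
            rw [Finset.range_add_one, Finset.set_biUnion_insert, indicator_union_of_disjoint hdisj]
            rfl
          rw [this, hadd _ _ (hint _ (hm n))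
            (hint _ (Finset.measurableSet_biUnion _ fun i _ => hm i)), ih n, ihn, add_zero]
      have hbd : ∀ n, |d ((⋃ i, s i).indicator (fun _ => (1:ℝ)))| ≤
          K * ((uM.real (⋃ i, s i)) - uM.real (⋃ i ∈ Finset.range n, s i)) := by
        intro n
        have hmn : MeasurableSet (⋃ i ∈ Finset.range n, s i) :=
          Finset.measurableSet_biUnion _ fun i _ => hm i
        have hss : (⋃ i ∈ Finset.range n, s i) ⊆ ⋃ i, s i :=
          iUnion₂_subset fun i _ => subset_iUnion s i
        have h1 := hb _ ((hint _ (MeasurableSet.iUnion hm)).sub (hint _ hmn))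
        rw [hsub _ _ (hint _ (MeasurableSet.iUnion hm)) (hint _ hmn), hpart, sub_zero] at h1
        refine h1.trans_eq ?_
        congr 1
        rw [← integral_indicator_one (MeasurableSet.iUnion hm), ← integral_indicator_one hmn,
          ← integral_sub]
        · apply integral_congr_ae
          refine Eventually.of_forall fun t => ?_
          have : (⋃ i ∈ Finset.range n, s i).indicator (fun _ => (1:ℝ)) t ≤
            (⋃ i, s i).indicator (fun _ => (1:ℝ)) t :=
            indicator_le_indicator_of_subset hss (fun _ => zero_le_one) t
          simp only [Pi.sub_apply]
          rw [abs_of_nonneg (by linarith)]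
          rfl
        · exact hint _ (MeasurableSet.iUnion hm)
        · exact hint _ hmn
      have hlim : Tendsto (fun n => K * ((uM.real (⋃ i, s i)) -
          uM.real (⋃ i ∈ Finset.range n, s i))) atTop (nhds (K * 0)) := by
        apply Tendsto.const_mul
        have h3 : (fun n => uM.real (⋃ i ∈ Finset.range n, s i)) =
            fun n => ∑ i ∈ Finset.range n, uM.real (s i) := by
          funext n
          exact measureReal_biUnion_finset (fun i _ j _ hij => hd hij) (fun i _ => hm i)
        have h4 : HasSum (fun i => uM.real (s i)) (uM.real (⋃ i, s i)) := by
          have := measure_iUnion (μ := uM) hd hm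
          have h5 : ∑' i, uM (s i) ≠ ⊤ := by rw [← this]; exact measure_ne_top _ _
          have h6 := ENNReal.hasSum_toReal h5
          rw [← ENNReal.tsum_toReal_eq (fun i => measure_ne_top _ _), ← this] at h6
          exact h6
        have h7 := h4.tendsto_sum_nat
        rw [← h3] at h7
        have := (tendsto_const_nhds (x := uM.real (⋃ i, s i))).sub h7
        simpa using this
      rw [mul_zero] at hlim
      exact abs_nonpos_iff.1 (ge_of_tendsto' hlim hbd)
  intro f hf
  refine Integrable.induction (μ := uM) (fun f => d f = 0) ?_ ?_ ?_ ?_ hf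
  · intro c s hs _
    have : s.indicator (fun _ => c) = c • s.indicator (fun _ => (1:ℝ)) := by
      ext t; by_cases h : t ∈ s <;> simp [h]
    rw [this, hsmul _ _ (hint s hs), hset s hs, mul_zero]
  · intro f g _ hf hg h1 h2
    rw [hadd f g hf hg, h1, h2, add_zero]
  · have hlip : LipschitzWith (Real.toNNReal K) (fun f : ℝ →₁[uM] ℝ => d f) := by
      refine LipschitzWith.of_dist_le_mul fun f g => ?_
      have hf := L1.integrable_coeFn f
      have hg := L1.integrable_coeFn g
      rw [Real.dist_eq, ← hsub _ _ hf hg]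
      refine (hb _ (hf.sub hg)).trans ?_
      have h1 : dist f g = ∫ t, |((f : ℝ → ℝ) - (g : ℝ → ℝ)) t| ∂uM := by
        rw [dist_eq_norm, L1.norm_eq_integral_norm]
        apply integral_congr_ae
        filter_upwards [Lp.coeFn_sub f g] with t ht
        rw [ht]; rfl
      rw [h1]
      exact mul_le_mul_of_nonneg_right (Real.le_coe_toNNReal K)
        (integral_nonneg fun t => abs_nonneg _)
    exact isClosed_singleton.preimage hlip.continuous
  · intro f g hfg hf h
    rw [← hae f g hf hfg]; exact h

lemma integral_unit_eq (f : ℝ → ℝ) : ∫ x in (0:ℝ)..1, f x = ∫ x, f x ∂uM := by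
  rw [intervalIntegral.integral_of_le zero_le_one, integral_Ioc_eq_integral_Ioo]

lemma mono_ae_diff {f : ℝ → ℝ} (hf : MonotoneOn f (Icc 0 1)) :
    ∀ᵐ t ∂uM, DifferentiableAt ℝ f t := by
  have := hf.ae_differentiableWithinAt_of_mem
  rw [ae_restrict_iff' measurableSet_Ioo]
  filter_upwards [this] with t ht h
  exact (ht (Ioo_subset_Icc_self h)).differentiableAt (Icc_mem_nhds h.1 h.2)

lemma mono_deriv_nonneg {f : ℝ → ℝ} (hf : MonotoneOn f (Icc 0 1)) {t : ℝ} (ht : t ∈ Ioo (0:ℝ) 1) :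
    0 ≤ deriv f t := by
  rw [← derivWithin_of_mem_nhds (Icc_mem_nhds ht.1 ht.2)]
  exact hf.derivWithin_nonneg

lemma mono_deriv_integrable {f : ℝ → ℝ} (hf : MonotoneOn f (Icc 0 1)) :
    Integrable (deriv f) uM := by
  have h := (show MonotoneOn f (uIcc 0 1) by rwa [uIcc_of_le zero_le_one]).intervalIntegrable_deriv
  rw [intervalIntegrable_iff_integrableOn_Ioo_of_le zero_le_one] at h
  exact h

lemma mono_integral_deriv_le {f : ℝ → ℝ} (hf : MonotoneOn f (Icc 0 1)) :
    ∫ t, deriv f t ∂uM ≤ f 1 - f 0 := by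
  have h := (show MonotoneOn f (uIcc 0 1) by
    rwa [uIcc_of_le zero_le_one]).intervalIntegral_deriv_mem_uIcc
  have h01 : f 0 ≤ f 1 := hf (by simp) (by simp) zero_le_one
  rw [uIcc_of_le (by linarith), integral_unit_eq] at h
  exact h.2

/-- Fundamental theorem of calculus for `1`-Lipschitz functions on the unit interval. -/
lemma lip_integral {f : ℝ → ℝ} (hf : LipschitzOnWith 1 f (Icc 0 1)) {b : ℝ}
    (hb : b ∈ Icc (0:ℝ) 1) : ∫ t in (0:ℝ)..b, deriv f t = f b - f 0 := by
  refine (LipschitzOnWith.absolutelyContinuousOnInterval (K := 1)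
    (hf.mono ?_)).integral_deriv_eq_sub
  rw [uIcc_of_le hb.1]
  exact Icc_subset_Icc_right hb.2

lemma lip_abs_deriv_le {f : ℝ → ℝ} (hf : LipschitzOnWith 1 f (Icc 0 1)) {t : ℝ}
    (ht : t ∈ Ioo (0:ℝ) 1) : |deriv f t| ≤ 1 := by
  simpa using norm_deriv_le_of_lipschitzOn (Icc_mem_nhds ht.1 ht.2) hf

lemma lip_of_mono {f : ℝ → ℝ} (hf : MonotoneOn f (Icc 0 1))
    (h : ∀ a ∈ Icc (0:ℝ) 1, ∀ b ∈ Icc (0:ℝ) 1, a ≤ b → f b - f a ≤ b - a) :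
    LipschitzOnWith 1 f (Icc 0 1) := by
  refine LipschitzOnWith.of_dist_le_mul fun a ha b hb => ?_
  rw [Real.dist_eq, Real.dist_eq, NNReal.coe_one, one_mul]
  rcases le_total a b with hab | hab
  · have h1 := hf ha hb hab
    rw [abs_of_nonpos (by linarith), abs_of_nonpos (by linarith)]
    linarith [h a ha b hb hab]
  · have h1 := hf hb ha hab
    rw [abs_of_nonneg (by linarith), abs_of_nonneg (by linarith)]
    linarith [h b hb a ha hab]

lemma IsCopula.flip' {C : ℝ → ℝ → ℝ} (h : IsCopula C) : IsCopula (fun x y => C y x) := by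
  obtain ⟨h1, h2, h3, h4, h5⟩ := h
  refine ⟨h2, h1, h4, h3, ?_⟩
  intro x₁ x₂ y₁ y₂ a b c d e f
  have := h5 y₁ y₂ x₁ x₂ c d a b f e
  simp only
  linarith

lemma IsCopula.mono_sub {C : ℝ → ℝ → ℝ} (h : IsCopula C) {s₁ s₂ : ℝ} (h1 : s₁ ∈ Icc (0:ℝ) 1)
    (h2 : s₂ ∈ Icc (0:ℝ) 1) (h12 : s₁ ≤ s₂) :
    MonotoneOn (fun t => C t s₂ - C t s₁) (Icc 0 1) := by
  intro a ha b hb hab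
  have := h.2.2.2.2 a b s₁ s₂ ha hb h1 h2 hab h12
  simp only
  linarith

lemma IsCopula.mono {C : ℝ → ℝ → ℝ} (h : IsCopula C) {s : ℝ} (hs : s ∈ Icc (0:ℝ) 1) :
    MonotoneOn (fun t => C t s) (Icc 0 1) := by
  intro a ha b hb hab
  have := h.mono_sub (by simp) hs hs.1 ha hb hab
  simpa [h.1 a ha, h.1 b hb] using this

lemma IsCopula.lip {C : ℝ → ℝ → ℝ} (h : IsCopula C) {s : ℝ} (hs : s ∈ Icc (0:ℝ) 1) :
    LipschitzOnWith 1 (fun t => C t s) (Icc 0 1) := by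
  refine lip_of_mono (h.mono hs) fun a ha b hb hab => ?_
  have := h.mono_sub hs (by simp) hs.2 ha hb hab
  simp only [h.2.2.1 a ha, h.2.2.1 b hb] at this
  linarith

lemma IsCopula.d_nonneg {C : ℝ → ℝ → ℝ} (h : IsCopula C) {s : ℝ} (hs : s ∈ Icc (0:ℝ) 1)
    {t : ℝ} (ht : t ∈ Ioo (0:ℝ) 1) : 0 ≤ deriv (fun u => C u s) t :=
  mono_deriv_nonneg (h.mono hs) ht

lemma IsCopula.d_abs_le {C : ℝ → ℝ → ℝ} (h : IsCopula C) {s : ℝ} (hs : s ∈ Icc (0:ℝ) 1)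
    {t : ℝ} (ht : t ∈ Ioo (0:ℝ) 1) : |deriv (fun u => C u s) t| ≤ 1 :=
  lip_abs_deriv_le (h.lip hs) ht

lemma IsCopula.d_mono {C : ℝ → ℝ → ℝ} (h : IsCopula C) {s₁ s₂ : ℝ} (h1 : s₁ ∈ Icc (0:ℝ) 1)
    (h2 : s₂ ∈ Icc (0:ℝ) 1) (h12 : s₁ ≤ s₂) :
    ∀ᵐ t ∂uM, deriv (fun u => C u s₁) t ≤ deriv (fun u => C u s₂) t := by
  filter_upwards [mono_ae_diff (h.mono h1), mono_ae_diff (h.mono h2),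
    ae_restrict_mem measurableSet_Ioo] with t d1 d2 ht
  have := mono_deriv_nonneg (h.mono_sub h1 h2 h12) ht
  rw [deriv_fun_sub d2 d1] at this
  linarith

lemma IsCopula.d_one {C : ℝ → ℝ → ℝ} (h : IsCopula C) {t : ℝ} (ht : t ∈ Ioo (0:ℝ) 1) :
    deriv (fun u => C u 1) t = 1 := by
  have : (fun u => C u 1) =ᶠ[nhds t] fun u => u := by
    filter_upwards [Icc_mem_nhds ht.1 ht.2] with u hu using h.2.2.1 u hu
  rw [this.deriv_eq, deriv_id'']

lemma IsCopula.d_zero {C : ℝ → ℝ → ℝ} (h : IsCopula C) {t : ℝ} (ht : t ∈ Ioo (0:ℝ) 1) :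
    deriv (fun u => C u 0) t = 0 := by
  have : (fun u => C u 0) =ᶠ[nhds t] fun _ => 0 := by
    filter_upwards [Icc_mem_nhds ht.1 ht.2] with u hu using h.1 u hu
  rw [this.deriv_eq, deriv_const]

lemma IsCopula.mul_integrable {C : ℝ → ℝ → ℝ} (h : IsCopula C) {s : ℝ} (hs : s ∈ Icc (0:ℝ) 1)
    {φ : ℝ → ℝ} (hφ : Integrable φ uM) :
    Integrable (fun t => φ t * deriv (fun u => C u s) t) uM := by
  refine hφ.mul_bdd (c := 1) (measurable_deriv _).aestronglyMeasurable ?_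
  filter_upwards [ae_restrict_mem measurableSet_Ioo] with t ht
  exact h.d_abs_le hs ht

/-- The operator `φ ↦ ∫ φ ∂₁C(·, s)`. -/
noncomputable def opT (C : ℝ → ℝ → ℝ) (φ : ℝ → ℝ) (s : ℝ) : ℝ :=
  ∫ t, φ t * deriv (fun u => C u s) t ∂uM

lemma opT_mono {C : ℝ → ℝ → ℝ} (h : IsCopula C) {φ : ℝ → ℝ} (hφ : Integrable φ uM)
    (h0 : ∀ᵐ t ∂uM, 0 ≤ φ t) : MonotoneOn (opT C φ) (Icc 0 1) := by
  intro a ha b hb hab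
  refine integral_mono_ae (h.mul_integrable ha hφ) (h.mul_integrable hb hφ) ?_
  filter_upwards [h0, h.d_mono ha hb hab] with t h1 h2
  exact mul_le_mul_of_nonneg_left h2 h1

lemma opT_one {C : ℝ → ℝ → ℝ} (h : IsCopula C) (φ : ℝ → ℝ) : opT C φ 1 = ∫ t, φ t ∂uM := by
  apply integral_congr_ae
  filter_upwards [ae_restrict_mem measurableSet_Ioo] with t ht
  simp [h.d_one ht]

lemma opT_zero {C : ℝ → ℝ → ℝ} (h : IsCopula C) (φ : ℝ → ℝ) : opT C φ 0 = 0 := by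
  apply integral_eq_zero_of_ae
  filter_upwards [ae_restrict_mem measurableSet_Ioo] with t ht
  simp [h.d_zero ht]

lemma opT_add {C : ℝ → ℝ → ℝ} (h : IsCopula C) {φ χ : ℝ → ℝ} (hφ : Integrable φ uM)
    (hχ : Integrable χ uM) {s : ℝ} (hs : s ∈ Icc (0:ℝ) 1) :
    opT C (φ + χ) s = opT C φ s + opT C χ s := by
  unfold opT
  rw [← integral_add (h.mul_integrable hs hφ) (h.mul_integrable hs hχ)]
  simp only [Pi.add_apply, add_mul]

lemma opT_smul (C : ℝ → ℝ → ℝ) (c : ℝ) (φ : ℝ → ℝ) (s : ℝ) :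
    opT C (c • φ) s = c * opT C φ s := by
  unfold opT
  rw [← integral_const_mul]
  simp only [Pi.smul_apply, smul_eq_mul, mul_assoc]

lemma deriv_congr_Icc {f g : ℝ → ℝ} (h : ∀ t ∈ Icc (0:ℝ) 1, f t = g t) {t : ℝ}
    (ht : t ∈ Ioo (0:ℝ) 1) : deriv f t = deriv g t := by
  apply Filter.EventuallyEq.deriv_eq
  filter_upwards [Icc_mem_nhds ht.1 ht.2] with u hu using h u hu

/-- Almost everywhere differentiability and the `L¹` bound for the derivative of `opT C φ`. -/
lemma opT_deriv {C : ℝ → ℝ → ℝ} (h : IsCopula C) {φ : ℝ → ℝ} (hφ : Integrable φ uM) :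
    (∀ᵐ s ∂uM, DifferentiableAt ℝ (opT C φ) s) ∧ Integrable (deriv (opT C φ)) uM ∧
    ∫ s, |deriv (opT C φ) s| ∂uM ≤ ∫ t, |φ t| ∂uM := by
  set p : ℝ → ℝ := fun t => max (φ t) 0
  set q : ℝ → ℝ := fun t => max (-φ t) 0
  have hp : Integrable p uM := hφ.pos_part
  have hq : Integrable q uM := hφ.neg_part
  have mp := opT_mono h hp (Eventually.of_forall fun t => le_max_right _ _)
  have mq := opT_mono h hq (Eventually.of_forall fun t => le_max_right _ _)
  have heq : ∀ s ∈ Icc (0:ℝ) 1, opT C φ s = opT C p s - opT C q s := by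
    intro s hs
    have : p = φ + q := by
      funext t
      simp only [p, q, Pi.add_apply]
      rcases le_total 0 (φ t) with h | h
      · rw [max_eq_left h, max_eq_right (by linarith)]; ring
      · rw [max_eq_right h, max_eq_left (by linarith)]; ring
    rw [this, opT_add h hφ hq hs]; ring
  have hd : ∀ᵐ s ∂uM, DifferentiableAt ℝ (opT C φ) s ∧
      deriv (opT C φ) s = deriv (opT C p) s - deriv (opT C q) s := by
    filter_upwards [mono_ae_diff mp, mono_ae_diff mq, ae_restrict_mem measurableSet_Ioo]
      with s h1 h2 hs
    have hev : opT C φ =ᶠ[nhds s] fun s => opT C p s - opT C q s := by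
      filter_upwards [Icc_mem_nhds hs.1 hs.2] with u hu using heq u hu
    refine ⟨(h1.sub h2).congr_of_eventuallyEq hev, ?_⟩
    rw [hev.deriv_eq, deriv_fun_sub h1 h2]
  have ip := mono_deriv_integrable mp
  have iq := mono_deriv_integrable mq
  have hi : Integrable (deriv (opT C φ)) uM := by
    refine (ip.sub iq).congr ?_
    filter_upwards [hd] with s hs
    rw [hs.2]; rfl
  refine ⟨hd.mono fun s hs => hs.1, hi, ?_⟩
  calc ∫ s, |deriv (opT C φ) s| ∂uM
      ≤ ∫ s, (deriv (opT C p) s + deriv (opT C q) s) ∂uM := by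
        refine integral_mono_ae hi.abs (ip.add iq) ?_
        filter_upwards [hd, ae_restrict_mem measurableSet_Ioo] with s hs h01
        have h1 := mono_deriv_nonneg mp h01
        have h2 := mono_deriv_nonneg mq h01
        rw [hs.2, abs_le]
        constructor <;> linarith
    _ = ∫ s, deriv (opT C p) s ∂uM + ∫ s, deriv (opT C q) s ∂uM := integral_add ip iq
    _ ≤ ∫ t, p t ∂uM + ∫ t, q t ∂uM := by
        have h1 := mono_integral_deriv_le mp
        have h2 := mono_integral_deriv_le mq
        rw [opT_one h, opT_zero h] at h1 h2
        linarith
    _ = ∫ t, |φ t| ∂uM := by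
        rw [← integral_add hp hq]
        congr 1
        funext t
        simp only [p, q]
        rcases le_total 0 (φ t) with h | h
        · rw [max_eq_left h, max_eq_right (by linarith), abs_of_nonneg h]; ring
        · rw [max_eq_right h, max_eq_left (by linarith), abs_of_nonpos h]; ring

/-- For `0 ≤ ψ ≤ 1`, `opT C ψ` is `1`-Lipschitz. -/
lemma opT_lip {C : ℝ → ℝ → ℝ} (h : IsCopula C) {ψ : ℝ → ℝ} (hψ : Integrable ψ uM)
    (h0 : ∀ᵐ t ∂uM, 0 ≤ ψ t) (h1 : ∀ᵐ t ∂uM, ψ t ≤ 1) :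
    LipschitzOnWith 1 (opT C ψ) (Icc 0 1) := by
  refine lip_of_mono (opT_mono h hψ h0) fun a ha b hb hab => ?_
  have key : opT C ψ b - opT C ψ a ≤ opT C (fun _ => 1) b - opT C (fun _ => 1) a := by
    have i1 := integrable_const (μ := uM) (1:ℝ)
    unfold opT
    rw [← integral_sub (h.mul_integrable hb hψ) (h.mul_integrable ha hψ),
      ← integral_sub (h.mul_integrable hb i1) (h.mul_integrable ha i1)]
    refine integral_mono_ae ((h.mul_integrable hb hψ).sub (h.mul_integrable ha hψ))
      ((h.mul_integrable hb i1).sub (h.mul_integrable ha i1)) ?_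
    filter_upwards [h0, h1, h.d_mono ha hb hab] with t h0 h1 h2
    nlinarith
  have hval : ∀ s ∈ Icc (0:ℝ) 1, opT C (fun _ => 1) s = s := by
    intro s hs
    unfold opT
    simp only [one_mul]
    rw [← integral_unit_eq, lip_integral (h.lip hs) (by simp), h.2.2.2.1 s hs, h.2.1 s hs, sub_zero]
  rw [hval b hb, hval a ha] at key
  exact key

lemma integral_step (a : ℝ) : ∃ b ∈ Icc (0:ℝ) 1, ∀ f : ℝ → ℝ,
    ∫ t, (Iic a).indicator (fun _ => (1:ℝ)) t * f t ∂uM = ∫ t in (0:ℝ)..b, f t := by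
  refine ⟨max 0 (min a 1), ⟨le_max_left _ _, max_le zero_le_one (min_le_right _ _)⟩, fun f => ?_⟩
  rw [intervalIntegral.integral_of_le (le_max_left _ _), uM, ← integral_Ioc_eq_integral_Ioo]
  have : (fun t => (Iic a).indicator (fun _ => (1:ℝ)) t * f t) = (Iic a).indicator f := by
    funext t; by_cases h : t ∈ Iic a <;> simp [h]
  rw [this, setIntegral_indicator measurableSet_Iic]
  congr 2
  ext t
  simp only [mem_inter_iff, mem_Ioc, mem_Iic, le_max_iff, le_min_iff]
  constructor
  · rintro ⟨⟨h1, h2⟩, h3⟩; exact ⟨h1, Or.inr ⟨h3, h2⟩⟩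
  · rintro ⟨h1, h2 | h2⟩
    · linarith
    · exact ⟨⟨h1, h2.2⟩, h2.1⟩

/-- The key duality identity. -/
lemma key_identity {C : ℝ → ℝ → ℝ} (h : IsCopula C) {ψ : ℝ → ℝ} (hψ : Integrable ψ uM)
    (h0 : ∀ᵐ t ∂uM, 0 ≤ ψ t) (h1 : ∀ᵐ t ∂uM, ψ t ≤ 1) {φ : ℝ → ℝ} (hφ : Integrable φ uM) :
    ∫ s, deriv (opT C φ) s * ψ s ∂uM =
      ∫ t, φ t * deriv (opT (fun x y => C y x) ψ) t ∂uM := by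
  set S := opT (fun x y => C y x) ψ with hS
  have hSlip : LipschitzOnWith 1 S (Icc 0 1) := opT_lip h.flip' hψ h0 h1
  have hψb : ∀ᵐ t ∂uM, ‖ψ t‖ ≤ 1 := by
    filter_upwards [h0, h1] with t a b
    rw [Real.norm_eq_abs, abs_of_nonneg a]; exact b
  have i1 : ∀ φ, Integrable φ uM → Integrable (fun s => deriv (opT C φ) s * ψ s) uM := by
    intro φ hφ
    exact (opT_deriv h hφ).2.1.mul_bdd (c := 1) hψ.aestronglyMeasurable hψb
  have hSb : ∀ᵐ t ∂uM, ‖deriv S t‖ ≤ 1 := by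
    filter_upwards [ae_restrict_mem measurableSet_Ioo] with t ht
    exact lip_abs_deriv_le hSlip ht
  have i2 : ∀ φ, Integrable φ uM → Integrable (fun t => φ t * deriv S t) uM := by
    intro φ hφ
    exact hφ.mul_bdd (c := 1) (measurable_deriv _).aestronglyMeasurable hSb
  have main := zero_of_steps (fun φ => ∫ s, deriv (opT C φ) s * ψ s ∂uM -
      ∫ t, φ t * deriv S t ∂uM) 2 ?_ ?_ ?_ ?_ φ hφ
  · linarith
  · intro f g hf hg
    have e1 : ∫ s, deriv (opT C (f + g)) s * ψ s ∂uM =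
        ∫ s, deriv (opT C f) s * ψ s ∂uM + ∫ s, deriv (opT C g) s * ψ s ∂uM := by
      rw [← integral_add (i1 f hf) (i1 g hg)]
      apply integral_congr_ae
      filter_upwards [(opT_deriv h hf).1, (opT_deriv h hg).1, ae_restrict_mem measurableSet_Ioo]
        with s d1 d2 hs
      have := deriv_congr_Icc (f := opT C (f + g)) (g := fun s => opT C f s + opT C g s)
        (fun u hu => opT_add h hf hg hu) hs
      rw [this, deriv_fun_add d1 d2, add_mul]
    have e2 : ∫ t, (f + g) t * deriv S t ∂uM =
        ∫ t, f t * deriv S t ∂uM + ∫ t, g t * deriv S t ∂uM := by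
      rw [← integral_add (i2 f hf) (i2 g hg)]
      simp only [Pi.add_apply, add_mul]
    simp only [e1, e2]
    ring
  · intro c f hf
    have e0 : opT C (c • f) = fun s => c * opT C f s := funext fun s => opT_smul C c f s
    have e1 : ∫ s, deriv (opT C (c • f)) s * ψ s ∂uM =
        c * ∫ s, deriv (opT C f) s * ψ s ∂uM := by
      rw [← integral_const_mul, e0]
      apply integral_congr_ae
      filter_upwards with s
      rw [deriv_const_mul_field, mul_assoc]
    have e2 : ∫ t, (c • f) t * deriv S t ∂uM = c * ∫ t, f t * deriv S t ∂uM := by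
      rw [← integral_const_mul]
      simp only [Pi.smul_apply, smul_eq_mul, mul_assoc]
    simp only [e1, e2]
    ring
  · intro f hf
    have b1 : |∫ s, deriv (opT C f) s * ψ s ∂uM| ≤ ∫ t, |f t| ∂uM := by
      refine le_trans ?_ (opT_deriv h hf).2.2
      refine (abs_integral_le_integral_abs).trans ?_
      refine integral_mono_ae (i1 f hf).abs (opT_deriv h hf).2.1.abs ?_
      filter_upwards [hψb] with s hs
      rw [abs_mul]
      exact mul_le_of_le_one_right (abs_nonneg _) hs
    have b2 : |∫ t, f t * deriv S t ∂uM| ≤ ∫ t, |f t| ∂uM := by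
      refine (abs_integral_le_integral_abs).trans ?_
      refine integral_mono_ae (i2 f hf).abs hf.abs ?_
      filter_upwards [hSb] with s hs
      rw [abs_mul]
      exact mul_le_of_le_one_right (abs_nonneg _) hs
    refine (abs_sub _ _).trans ?_
    linarith
  · intro a
    obtain ⟨b, hb, hstep⟩ := integral_step a
    have e1 : ∀ s ∈ Icc (0:ℝ) 1, opT C ((Iic a).indicator (fun _ => (1:ℝ))) s = C b s := by
      intro s hs
      unfold opT
      rw [hstep, lip_integral (h.lip hs) hb, h.2.1 s hs, sub_zero]
    have e2 : ∫ s, deriv (opT C ((Iic a).indicator (fun _ => (1:ℝ)))) s * ψ s ∂uM = S b := by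
      rw [hS]
      unfold opT
      apply integral_congr_ae
      filter_upwards [ae_restrict_mem measurableSet_Ioo] with s hs
      have := deriv_congr_Icc e1 hs
      unfold opT at this
      rw [this, mul_comm]
    simp only [e2, hstep]
    rw [lip_integral hSlip hb, hS, opT_zero h.flip']
    ring

/-- The fold product of copulas is associative. -/
theorem foldProd_assoc (C₁ C₂ C₃ : ℝ → ℝ → ℝ)
    (h₁ : IsCopula C₁) (h₂ : IsCopula C₂) (h₃ : IsCopula C₃) :
    ∀ x ∈ Icc (0:ℝ) 1, ∀ y ∈ Icc (0:ℝ) 1,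
      foldProd (foldProd C₁ C₂) C₃ x y = foldProd C₁ (foldProd C₂ C₃) x y := by
  intro x hx y hy
  have hf := mono_deriv_integrable (h₁.flip'.mono hx)
  have hg := mono_deriv_integrable (h₃.mono hy)
  have key := key_identity h₂ (ψ := deriv (fun s => C₃ s y)) (φ := deriv (fun s => C₁ x s)) hg
    (by filter_upwards [ae_restrict_mem measurableSet_Ioo] with t ht using h₃.d_nonneg hy ht)
    (by filter_upwards [ae_restrict_mem measurableSet_Ioo] with t ht
          using (le_abs_self _).trans (h₃.d_abs_le hy ht)) hf
  have e1 : (fun s => foldProd C₁ C₂ x s) = opT C₂ (deriv (fun s => C₁ x s)) := by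
    funext s
    exact integral_unit_eq _
  have e2 : (fun t => foldProd C₂ C₃ t y) =
      opT (fun x y => C₂ y x) (deriv (fun s => C₃ s y)) := by
    funext t
    refine (integral_unit_eq _).trans ?_
    unfold opT
    simp only [mul_comm]
  rw [← e1, ← e2] at key
  refine (integral_unit_eq _).trans (key.trans (integral_unit_eq _).symm)
end

section
/- The Marshall–Olkin copula C_{α,β}(u,v) = min(u·v^{1-α}, v·u^{1-β}) with parameters 0 ≤ α, β < 1 has an absolutely continuous part whose density is bounded below by a strictly positive constant a.e. on [0,1]²; consequently the stationary Markov chain it generates is φ-mixing with geometric rate. -/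
open MeasureTheory ProbabilityTheory Set Filter

/-- The n-fold composition (n-step transition kernel) of a kernel. -/
noncomputable def kpow {α : Type*} [MeasurableSpace α] (κ : Kernel α α) : ℕ → Kernel α α
  | 0 => Kernel.id
  | n + 1 => κ ∘ₖ kpow κ n

/-- The uniform (Lebesgue) probability measure on `[0,1]`. -/
noncomputable def unif01 : Measure ℝ := volume.restrict (Icc (0:ℝ) 1)

/-- `κ` is the transition kernel of the stationary Markov chain generated by the copula `C`
(with uniform marginals), i.e. `κ x [0,y] = ∂₁C(x,y)` for a.e. `x`. -/
def IsCopulaKernel (C : ℝ → ℝ → ℝ) (κ : Kernel ℝ ℝ) : Prop :=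
  ∀ y ∈ Icc (0:ℝ) 1, ∀ᵐ x ∂unif01, κ x (Iic y) = ENNReal.ofReal (deriv (fun s => C s y) x)

/-- The second mixed partial derivative `∂²D/∂u∂v`. -/
noncomputable def mixedDeriv (D : ℝ → ℝ → ℝ) (x y : ℝ) : ℝ :=
  deriv (fun t => deriv (fun s => D s t) x) y

/-- The Marshall–Olkin copula `C_{α,β}(u,v) = min(u v^{1-α}, v u^{1-β})`. -/
noncomputable def MOcopula (α β : ℝ) (u v : ℝ) : ℝ :=
  min (u * v ^ (1 - α)) (v * u ^ (1 - β))


instance unif01_prob : IsProbabilityMeasure unif01 := by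
  constructor
  simp [unif01]

lemma smul_unif_le (ν : Measure ℝ) [IsProbabilityMeasure ν] (c : ℝ) (hc : 0 ≤ c)
    (h : ∀ p q : ℚ, (0:ℝ) < p → (p:ℝ) < q → (q:ℝ) < 1 → c * (q - p) ≤ ν.real (Ioc (p:ℝ) q)) :
    ENNReal.ofReal c • unif01 ≤ ν := by
  have key : ∀ a b : ℝ, (ENNReal.ofReal c • unif01) (Ioc a b) ≤ ν (Ioc a b) := by
    intro a b
    have h1 : (ENNReal.ofReal c • unif01) (Ioc a b)
        = ENNReal.ofReal (c * (min b 1 - max a 0)) := by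
      have : unif01 (Ioc a b) = ENNReal.ofReal (min b 1 - max a 0) := by
        unfold unif01
        rw [Measure.restrict_congr_set (Ioc_ae_eq_Icc (a := (0:ℝ)) (b := 1)).symm,
          Measure.restrict_apply measurableSet_Ioc, Ioc_inter_Ioc, Real.volume_Ioc]
      rw [Measure.smul_apply, this, smul_eq_mul, ENNReal.ofReal_mul hc]
    rw [h1]
    apply ENNReal.ofReal_le_of_le_toReal
    change _ ≤ ν.real _
    set b' := min b 1
    set a' := max a 0
    have ha1 : a ≤ a' := le_max_left _ _
    have ha2 : 0 ≤ a' := le_max_right _ _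
    have hb1 : b' ≤ b := min_le_left _ _
    have hb2 : b' ≤ 1 := min_le_right _ _
    rcases le_or_gt b' a' with hab | hab
    · have : c * (b' - a') ≤ 0 := mul_nonpos_of_nonneg_of_nonpos hc (by linarith)
      exact this.trans measureReal_nonneg
    by_contra! hlt
    have hcpos : 0 < c := by
      rcases hc.eq_or_lt with h0 | h0
      · rw [← h0] at hlt
        have : 0 ≤ ν.real (Ioc a b) := measureReal_nonneg
        linarith
      · exact h0
    set m := ν.real (Ioc a b) with hm
    have hm0 : 0 ≤ m := measureReal_nonneg
    set ε := (b' - a' - m / c) / 2 with hε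
    have hmc : m / c < b' - a' := by rw [div_lt_iff₀ hcpos]; linarith
    have hmc0 : 0 ≤ m / c := by positivity
    have hε0 : 0 < ε := by rw [hε]; linarith
    obtain ⟨p, hp1, hp2⟩ := exists_rat_btwn (show a' < a' + ε by linarith)
    have hlast : max (b' - ε) p < b' := by
      apply max_lt
      · linarith
      · linarith
    obtain ⟨q, hq1, hq2⟩ := exists_rat_btwn hlast
    have hq3 : b' - ε < q := (le_max_left _ _).trans_lt hq1
    have hq4 : (p:ℝ) < q := (le_max_right _ _).trans_lt hq1
    have := h p q (by linarith) hq4 (by linarith)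
    have h2 : ν.real (Ioc (p:ℝ) q) ≤ m :=
      measureReal_mono (Ioc_subset_Ioc (by linarith) (by linarith))
    have h3 : m = c * (m / c) := by field_simp
    have h4 : c * (q - p) ≤ c * (m / c) := by linarith
    have h5 := le_of_mul_le_mul_left h4 hcpos
    linarith
  have h2 : (ENNReal.ofReal c • unif01).toOuterMeasure ≤ (cdf ν).outer := by
    unfold StieltjesFunction.outer
    rw [OuterMeasure.le_ofFunction]
    intro s
    rw [StieltjesFunction.length_eq]
    refine le_iInf fun a => le_iInf fun b => le_iInf fun hs => ?_
    rw [← StieltjesFunction.measure_Ioc, measure_cdf]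
    refine le_trans ?_ (key a b)
    have hbot : (botSet : Set ℝ) = ∅ := by
      ext x
      simp [botSet, not_isBot]
    rw [hbot, sdiff_empty] at hs
    exact measure_mono hs
  intro s
  have h3 := h2 s
  have h4 : (cdf ν).outer s = ν s := by
    conv_rhs => rw [← measure_cdf ν]
    rw [StieltjesFunction.measure]
    rfl
  rw [← h4]
  exact h3

lemma kpow_markov (κ : Kernel ℝ ℝ) [IsMarkovKernel κ] (n : ℕ) : IsMarkovKernel (kpow κ n) := by
  induction n with
  | zero => unfold kpow; infer_instance
  | succ n ih => unfold kpow; infer_instance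

lemma kpow_comm (κ : Kernel ℝ ℝ) (n : ℕ) : κ ∘ₖ kpow κ n = kpow κ n ∘ₖ κ := by
  induction n with
  | zero => simp [kpow]
  | succ n ih =>
    change κ ∘ₖ (κ ∘ₖ kpow κ n) = (κ ∘ₖ kpow κ n) ∘ₖ κ
    rw [Kernel.comp_assoc, ← ih]

lemma kpow_inv (κ : Kernel ℝ ℝ) (μ : Measure ℝ) (hinv : μ.bind κ = μ) (n : ℕ) :
    μ.bind (kpow κ n) = μ := by
  induction n with
  | zero => simp [kpow]
  | succ n ih =>
    change μ.bind (κ ∘ₖ kpow κ n) = μ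
    rw [← Measure.comp_assoc, ih, hinv]

lemma integral_kernel (κ : Kernel ℝ ℝ) [IsMarkovKernel κ] (η : Measure ℝ) [IsFiniteMeasure η]
    (B : Set ℝ) (hB : MeasurableSet B) :
    ∫ y, (κ y B).toReal ∂η = ((η.bind κ) B).toReal := by
  rw [integral_toReal (κ.measurable_coe hB).aemeasurable
    (ae_of_all _ fun y => measure_lt_top _ _), Measure.bind_apply hB κ.aemeasurable]

lemma doeblin (κ : Kernel ℝ ℝ) [IsMarkovKernel κ] (μ : Measure ℝ) [IsProbabilityMeasure μ]
    (hinv : μ.bind κ = μ) (c : ℝ) (hc0 : 0 < c) (hc1 : c < 1)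
    (hm : ∀ᵐ x ∂μ, ENNReal.ofReal c • μ ≤ κ x) (n : ℕ) :
    ∀ᵐ x ∂μ, ∀ B : Set ℝ, MeasurableSet B →
      |(kpow κ n x B).toReal - (μ B).toReal| ≤ (1 - c) ^ n := by
  induction n with
  | zero =>
    refine ae_of_all _ fun x B hB => ?_
    have := kpow_markov κ 0
    have h1 : (kpow κ 0 x B).toReal ≤ 1 := measureReal_le_one (μ := kpow κ 0 x)
    have h2 : (μ B).toReal ≤ 1 := measureReal_le_one (μ := μ)
    have h3 : 0 ≤ (kpow κ 0 x B).toReal := ENNReal.toReal_nonneg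
    have h4 : 0 ≤ (μ B).toReal := ENNReal.toReal_nonneg
    rw [pow_zero, abs_le]
    constructor <;> linarith
  | succ n ih =>
    have hmk := kpow_markov κ n
    have ih' : ∀ᵐ x ∂μ, ∀ᵐ y ∂(κ x), ∀ B : Set ℝ, MeasurableSet B →
        |(kpow κ n y B).toReal - (μ B).toReal| ≤ (1 - c) ^ n := by
      apply Measure.ae_ae_of_ae_bind κ.aemeasurable
      rw [hinv]
      exact ih
    filter_upwards [ih', hm] with x hx hmx B hB
    set f : ℝ → ℝ := fun y => (kpow κ n y B).toReal - (μ B).toReal with hf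
    have hfm : Measurable fun y => (kpow κ n y B).toReal :=
      ((kpow κ n).measurable_coe hB).ennreal_toReal
    have hint : ∀ η : Measure ℝ, IsFiniteMeasure η →
        Integrable (fun y => (kpow κ n y B).toReal) η := by
      intro η hη
      refine Integrable.of_bound hfm.aestronglyMeasurable 1 (ae_of_all _ fun y => ?_)
      rw [Real.norm_of_nonneg ENNReal.toReal_nonneg]
      exact measureReal_le_one (μ := kpow κ n y)
    have hfint : ∀ η : Measure ℝ, IsFiniteMeasure η → Integrable f η := fun η hη =>
      (hint η hη).sub (integrable_const _)
    have hfμ : ∫ y, f y ∂μ = 0 := by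
      rw [hf, integral_sub (hint μ inferInstance) (integrable_const _), integral_kernel _ _ _ hB,
        kpow_inv κ μ hinv]
      simp
    have hfκ : ∫ y, f y ∂(κ x) = (kpow κ (n+1) x B).toReal - (μ B).toReal := by
      rw [hf, integral_sub (hint _ inferInstance) (integrable_const _), integral_kernel _ _ _ hB]
      change _ = ((κ ∘ₖ kpow κ n) x B).toReal - _
      rw [kpow_comm, Kernel.comp_apply]
      simp
    have hfin : IsFiniteMeasure (ENNReal.ofReal c • μ) := Measure.smul_finite _ ENNReal.ofReal_ne_top
    set ρ := κ x - ENNReal.ofReal c • μ with hρ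
    have hdec : ρ + ENNReal.ofReal c • μ = κ x := Measure.sub_add_cancel_of_le hmx
    have hρle : ρ ≤ κ x := Measure.sub_le
    have hρfin : IsFiniteMeasure ρ := isFiniteMeasure_of_le _ hρle
    have hρuniv : ρ.real univ = 1 - c := by
      have h1 : (ρ + ENNReal.ofReal c • μ).real univ = 1 := by rw [hdec]; simp
      rw [measureReal_add_apply] at h1
      have h2 : (ENNReal.ofReal c • μ).real univ = c := by
        simp [Measure.real, hc0.le]
      linarith
    rw [← hfκ, ← hdec, integral_add_measure (hfint _ hρfin) (hfint _ hfin), integral_smul_measure,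
      hfμ, smul_zero, add_zero, ← Real.norm_eq_abs, pow_succ, ← hρuniv]
    rw [hρuniv]
    have := norm_integral_le_of_norm_le_const (μ := ρ) (f := f) (C := (1 - c) ^ n) (by
      apply ae_mono hρle
      filter_upwards [hx] with y hy
      exact hy B hB)
    rwa [hρuniv] at this

noncomputable def moG (α β x y : ℝ) : ℝ :=
  if x ^ β < y ^ α then y ^ (1 - α) else (1 - β) * y * x ^ (-β)

def moE (α β x y : ℝ) : Prop := x ^ β ≠ y ^ α ∨ (α = 0 ∧ β = 0)

lemma mo_left {α β x y : ℝ} (hx : 0 < x) (hy : 0 < y) (h : x ^ β ≤ y ^ α) :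
    MOcopula α β x y = x * y ^ (1 - α) := by
  unfold MOcopula
  apply min_eq_left
  rw [Real.rpow_sub hy, Real.rpow_sub hx, Real.rpow_one, Real.rpow_one]
  have h1 := Real.rpow_pos_of_pos hy α
  have h2 := Real.rpow_pos_of_pos hx β
  rw [mul_div_assoc', mul_div_assoc', mul_comm y x]
  exact div_le_div_of_nonneg_left (by positivity) h2 h

lemma mo_right {α β x y : ℝ} (hx : 0 < x) (hy : 0 < y) (h : y ^ α ≤ x ^ β) :
    MOcopula α β x y = y * x ^ (1 - β) := by
  unfold MOcopula
  apply min_eq_right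
  rw [Real.rpow_sub hy, Real.rpow_sub hx, Real.rpow_one, Real.rpow_one]
  have h1 := Real.rpow_pos_of_pos hy α
  have h2 := Real.rpow_pos_of_pos hx β
  rw [mul_div_assoc', mul_div_assoc', mul_comm y x]
  exact div_le_div_of_nonneg_left (by positivity) h1 h

lemma hasDeriv_right {β x y : ℝ} (hx : 0 < x) :
    HasDerivAt (fun s : ℝ => y * s ^ (1 - β)) ((1 - β) * y * x ^ (-β)) x := by
  have := (Real.hasDerivAt_rpow_const (x := x) (p := 1 - β) (Or.inl hx.ne')).const_mul y
  have e : y * ((1 - β) * x ^ (1 - β - 1)) = (1 - β) * y * x ^ (-β) := by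
    rw [show (1 - β - 1) = -β by ring]
    ring
  rwa [e] at this

lemma mo_deriv {α β x y : ℝ} (hx : 0 < x) (hy : 0 < y) (h : moE α β x y) :
    HasDerivAt (fun s => MOcopula α β s y) (moG α β x y) x := by
  have hpos : ∀ᶠ s in nhds x, 0 < s := lt_mem_nhds hx
  have hcont : ContinuousAt (fun s : ℝ => s ^ β) x :=
    Real.continuousAt_rpow_const _ _ (Or.inl hx.ne')
  unfold moG
  rcases h with h | ⟨h1, h2⟩
  · rcases lt_or_gt_of_ne h with h | h
    · rw [if_pos h]
      have hev : ∀ᶠ s in nhds x, s ^ β < y ^ α := hcont.eventually (gt_mem_nhds h)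
      have h1 : HasDerivAt (fun s : ℝ => s * y ^ (1 - α)) (y ^ (1 - α)) x := by
        simpa using (hasDerivAt_id x).mul_const (y ^ (1 - α))
      refine h1.congr_of_eventuallyEq ?_
      filter_upwards [hpos, hev] with s hs hs2
      exact mo_left hs hy hs2.le
    · rw [if_neg h.le.not_gt]
      have hev : ∀ᶠ s in nhds x, y ^ α < s ^ β := hcont.eventually (lt_mem_nhds h)
      refine (hasDeriv_right hx).congr_of_eventuallyEq ?_
      filter_upwards [hpos, hev] with s hs hs2
      exact mo_right hs hy hs2.le
  · subst h1 h2
    simp only [Real.rpow_zero, lt_irrefl, if_false]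
    refine (hasDeriv_right hx).congr_of_eventuallyEq ?_
    filter_upwards [hpos] with s hs
    exact mo_right hs hy (by simp)

lemma one_le_rpow_neg {x β : ℝ} (hx : 0 < x) (hx1 : x < 1) (hβ : 0 ≤ β) : 1 ≤ x ^ (-β) :=
  Real.one_le_rpow_of_pos_of_le_one_of_nonpos hx hx1.le (by linarith)

lemma mo_mixed {α β x y : ℝ} (hα : α ∈ Ico (0:ℝ) 1) (hβ : β ∈ Ico (0:ℝ) 1)
    (hx : x ∈ Ioo (0:ℝ) 1) (hy : y ∈ Ioo (0:ℝ) 1) (h : moE α β x y) :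
    min (1 - α) (1 - β) ≤ mixedDeriv (MOcopula α β) x y := by
  have hpos : ∀ᶠ s in nhds y, 0 < s := lt_mem_nhds hy.1
  have hcont : ContinuousAt (fun s : ℝ => s ^ α) y :=
    Real.continuousAt_rpow_const _ _ (Or.inl hy.1.ne')
  have hR : HasDerivAt (fun t : ℝ => (1 - β) * t * x ^ (-β)) ((1 - β) * x ^ (-β)) y := by
    simpa using ((hasDerivAt_id y).const_mul (1 - β)).mul_const (x ^ (-β))
  have hRb : min (1 - α) (1 - β) ≤ (1 - β) * x ^ (-β) := by
    have := one_le_rpow_neg hx.1 hx.2 hβ.1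
    have h2 := min_le_right (1 - α) (1 - β)
    nlinarith [hβ.2]
  unfold mixedDeriv
  rcases h with h | ⟨h1, h2⟩
  · rcases lt_or_gt_of_ne h with h | h
    · have hev : ∀ᶠ s in nhds y, x ^ β < s ^ α := hcont.eventually (lt_mem_nhds h)
      have h1 : HasDerivAt (fun t : ℝ => t ^ (1 - α)) ((1 - α) * y ^ (1 - α - 1)) y :=
        Real.hasDerivAt_rpow_const (Or.inl hy.1.ne')
      have h2 : HasDerivAt (fun t => deriv (fun s => MOcopula α β s t) x)
          ((1 - α) * y ^ (1 - α - 1)) y := by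
        refine h1.congr_of_eventuallyEq ?_
        filter_upwards [hpos, hev] with t ht ht2
        rw [(mo_deriv hx.1 ht (Or.inl ht2.ne)).deriv, moG, if_pos ht2]
      rw [h2.deriv, show 1 - α - 1 = -α by ring]
      have := one_le_rpow_neg hy.1 hy.2 hα.1
      have h2 := min_le_left (1 - α) (1 - β)
      nlinarith [hα.2]
    · have hev : ∀ᶠ s in nhds y, s ^ α < x ^ β := hcont.eventually (gt_mem_nhds h)
      have h2 : HasDerivAt (fun t => deriv (fun s => MOcopula α β s t) x)
          ((1 - β) * x ^ (-β)) y := by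
        refine hR.congr_of_eventuallyEq ?_
        filter_upwards [hpos, hev] with t ht ht2
        rw [(mo_deriv hx.1 ht (Or.inl ht2.ne')).deriv, moG, if_neg ht2.le.not_gt]
      rwa [h2.deriv]
  · have h3 : HasDerivAt (fun t => deriv (fun s => MOcopula α β s t) x)
        ((1 - β) * x ^ (-β)) y := by
      refine hR.congr_of_eventuallyEq ?_
      filter_upwards [hpos] with t ht
      rw [(mo_deriv hx.1 ht (Or.inr ⟨h1, h2⟩)).deriv, moG, if_neg]
      simp [h1, h2]
    rwa [h3.deriv]

lemma pow_incr {α a b : ℝ} (hα : α ∈ Ico (0:ℝ) 1) (ha : 0 < a) (hab : a < b) (hb : b < 1) :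
    (1 - α) * (b - a) ≤ b ^ (1 - α) - a ^ (1 - α) := by
  have hb0 : 0 < b := ha.trans hab
  have h1 : (1 + (a / b - 1)) ^ (1 - α) ≤ 1 + (1 - α) * (a / b - 1) := by
    apply rpow_one_add_le_one_add_mul_self
    · have : 0 < a / b := by positivity
      linarith
    · linarith [hα.2]
    · linarith [hα.1]
  rw [show 1 + (a / b - 1) = a / b by ring, Real.div_rpow ha.le hb0.le,
    div_le_iff₀ (Real.rpow_pos_of_pos hb0 _)] at h1
  have h2 : b ≤ b ^ (1 - α) := by
    conv_lhs => rw [← Real.rpow_one b]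
    exact Real.rpow_le_rpow_of_exponent_ge hb0 hb.le (by linarith [hα.1])
  have h3 : (1 - α) * (b - a) ≤ (1 - α) * (1 - a / b) * b ^ (1 - α) := by
    have h4 : (1 - α) * (b - a) = (1 - α) * (1 - a / b) * b := by field_simp
    rw [h4]
    apply mul_le_mul_of_nonneg_left h2
    apply mul_nonneg
    · linarith [hα.2]
    · have : a / b < 1 := by rw [div_lt_one hb0]; exact hab
      linarith
  nlinarith

lemma moG_right_le {α β x y : ℝ} (hβ : β ∈ Ico (0:ℝ) 1)
    (hx : 0 < x) (hy : 0 < y) (h : y ^ α ≤ x ^ β) :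
    (1 - β) * y * x ^ (-β) ≤ y ^ (1 - α) := by
  have h1 := Real.rpow_pos_of_pos hy α
  have h2 := Real.rpow_pos_of_pos hx β
  rw [Real.rpow_sub hy, Real.rpow_one, Real.rpow_neg hx.le, ← div_eq_mul_inv]
  have h3 : (1 - β) * y ≤ y := by nlinarith [hβ.1]
  exact div_le_div₀ hy.le h3 h1 h

lemma moG_incr {α β x a b : ℝ} (hα : α ∈ Ico (0:ℝ) 1) (hβ : β ∈ Ico (0:ℝ) 1)
    (hx : x ∈ Ioo (0:ℝ) 1) (ha : 0 < a) (hab : a < b) (hb : b < 1) :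
    min (1 - α) (1 - β) * (b - a) ≤ moG α β x b - moG α β x a := by
  have m1 : min (1 - α) (1 - β) * (b - a) ≤ (1 - α) * (b - a) :=
    mul_le_mul_of_nonneg_right (min_le_left _ _) (by linarith)
  have m2 : min (1 - α) (1 - β) * (b - a) ≤ (1 - β) * (b - a) :=
    mul_le_mul_of_nonneg_right (min_le_right _ _) (by linarith)
  have hp := pow_incr hα ha hab hb
  have hmono : a ^ α ≤ b ^ α := Real.rpow_le_rpow ha.le hab.le hα.1
  unfold moG
  by_cases h1 : x ^ β < a ^ α
  · rw [if_pos h1, if_pos (h1.trans_le hmono)]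
    linarith
  · rw [if_neg h1]
    by_cases h2 : x ^ β < b ^ α
    · rw [if_pos h2]
      have := moG_right_le hβ hx.1 ha (not_lt.1 h1)
      linarith
    · rw [if_neg h2]
      have h3 := one_le_rpow_neg hx.1 hx.2 hβ.1
      have h4 : 0 ≤ (1 - β) * (b - a) := mul_nonneg (by linarith [hβ.2]) (by linarith)
      nlinarith

lemma moG_nonneg {α β x y : ℝ} (hβ : β ∈ Ico (0:ℝ) 1) (hx : 0 < x) (hy : 0 < y) :
    0 ≤ moG α β x y := by
  have : 0 < 1 - β := by linarith [hβ.2]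
  unfold moG
  split_ifs <;> positivity

lemma moG_le_one {α β x y : ℝ} (hα : α ∈ Ico (0:ℝ) 1) (hβ : β ∈ Ico (0:ℝ) 1)
    (hx : 0 < x) (hy : y ∈ Ioo (0:ℝ) 1) : moG α β x y ≤ 1 := by
  have h1 : y ^ (1 - α) ≤ 1 := Real.rpow_le_one hy.1.le hy.2.le (by linarith [hα.2])
  unfold moG
  split_ifs with h
  · exact h1
  · exact (moG_right_le hβ hx hy.1 (not_lt.1 h)).trans h1

lemma moE_countable {α β y : ℝ} (hα : α ∈ Ico (0:ℝ) 1) (hβ : β ∈ Ico (0:ℝ) 1)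
    (hy : y ∈ Ioo (0:ℝ) 1) : {x | x ∈ Ioo (0:ℝ) 1 ∧ ¬ moE α β x y}.Countable := by
  apply Set.Subsingleton.countable
  rintro x ⟨hx, hxE⟩ x' ⟨hx', hxE'⟩
  simp only [moE, not_or, not_not] at hxE hxE'
  rcases hβ.1.eq_or_lt with h0 | h0
  · exfalso
    have hα0 : 0 < α := lt_of_le_of_ne hα.1 fun h => hxE.2 ⟨h.symm, h0.symm⟩
    have := hxE.1
    rw [← h0, Real.rpow_zero] at this
    have h2 := Real.rpow_lt_one hy.1.le hy.2 hα0
    linarith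
  · exact (Real.rpow_left_inj hx.1.le hx'.1.le h0.ne').1 (hxE.1.trans hxE'.1.symm)

lemma ae_Ioo : ∀ᵐ x ∂unif01, x ∈ Ioo (0:ℝ) 1 := by
  unfold unif01
  rw [Measure.restrict_congr_set (Ioo_ae_eq_Icc (a := (0:ℝ)) (b := 1)).symm]
  exact ae_restrict_mem measurableSet_Ioo

lemma ae_moE {α β y : ℝ} (hα : α ∈ Ico (0:ℝ) 1) (hβ : β ∈ Ico (0:ℝ) 1)
    (hy : y ∈ Ioo (0:ℝ) 1) : ∀ᵐ x ∂unif01, x ∈ Ioo (0:ℝ) 1 ∧ moE α β x y := by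
  have h : ∀ᵐ x ∂unif01, x ∉ {x | x ∈ Ioo (0:ℝ) 1 ∧ ¬ moE α β x y} := by
    unfold unif01
    exact ae_restrict_of_ae ((moE_countable hα hβ hy).ae_notMem volume)
  filter_upwards [ae_Ioo, h] with x hx hx2
  refine ⟨hx, ?_⟩
  by_contra hE
  exact hx2 ⟨hx, hE⟩

lemma measurable_moG (α β y : ℝ) : Measurable fun x => moG α β x y := by
  unfold moG
  refine Measurable.ite (measurableSet_lt (by fun_prop) (by fun_prop)) (by fun_prop) (by fun_prop)

lemma integrable_moG {α β y : ℝ} (hα : α ∈ Ico (0:ℝ) 1) (hβ : β ∈ Ico (0:ℝ) 1)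
    (hy : y ∈ Ioo (0:ℝ) 1) : Integrable (fun x => moG α β x y) unif01 := by
  refine Integrable.of_bound (measurable_moG α β y).aestronglyMeasurable 1 ?_
  filter_upwards [ae_Ioo] with x hx
  rw [Real.norm_of_nonneg (moG_nonneg hβ hx.1 hy.1)]
  exact moG_le_one hα hβ hx.1 hy

lemma integral_moG {α β y : ℝ} (hα : α ∈ Ico (0:ℝ) 1) (hβ : β ∈ Ico (0:ℝ) 1)
    (hy : y ∈ Ioo (0:ℝ) 1) : ∫ x, moG α β x y ∂unif01 = y := by
  have hi := integrable_moG hα hβ hy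
  have h := integral_eq_of_hasDerivAt_off_countable_of_le (fun s => MOcopula α β s y)
    (fun x => moG α β x y) zero_le_one (moE_countable hα hβ hy) (by
      unfold MOcopula
      apply Continuous.continuousOn
      have : Continuous fun s : ℝ => s ^ (1 - β) :=
        Real.continuous_rpow_const (by linarith [hβ.2])
      fun_prop) (by
      rintro x ⟨hx, hx2⟩
      refine mo_deriv hx.1 hy.1 ?_
      by_contra hE
      exact hx2 ⟨hx, hE⟩) (by
      rw [intervalIntegrable_iff_integrableOn_Icc_of_le zero_le_one]
      exact hi)
  rw [intervalIntegral.integral_of_le zero_le_one, ← integral_Icc_eq_integral_Ioc] at h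
  have h1 : MOcopula α β 1 y = y := by
    rw [mo_right one_pos hy.1]
    · simp
    · rw [Real.one_rpow]
      exact Real.rpow_le_one hy.1.le hy.2.le hα.1
  have h0 : MOcopula α β 0 y = 0 := by
    have : (1 - β) ≠ 0 := by linarith [hβ.2]
    simp [MOcopula, Real.zero_rpow this]
  simp only [h1, h0, sub_zero] at h
  exact h
/-- For `0 ≤ α, β < 1`, the Marshall–Olkin copula has the density of its absolutely
continuous part bounded below by a positive constant a.e.; consequently the stationary
Markov chain it generates is φ-mixing at a geometric rate. -/
theorem marshall_olkin_geometric_phi_mixing (α β : ℝ)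
    (hα : α ∈ Ico (0:ℝ) 1) (hβ : β ∈ Ico (0:ℝ) 1) :
    (∃ c : ℝ, 0 < c ∧
      ∀ᵐ p ∂(unif01.prod unif01), c ≤ mixedDeriv (MOcopula α β) p.1 p.2) ∧
    ∀ κ : Kernel ℝ ℝ, IsMarkovKernel κ → IsCopulaKernel (MOcopula α β) κ →
      ∃ D : ℝ, 0 ≤ D ∧ ∃ r ∈ Ioo (0:ℝ) 1, ∀ n : ℕ, 1 ≤ n →
        ∀ᵐ x ∂unif01, ∀ B : Set ℝ, MeasurableSet B →
          |(kpow κ n x B).toReal - (unif01 B).toReal| ≤ D * r ^ n := by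
  have hc0 : 0 < min (1 - α) (1 - β) := lt_min (by linarith [hα.2]) (by linarith [hβ.2])
  refine ⟨⟨min (1 - α) (1 - β), hc0, ?_⟩, ?_⟩
  · have hms : MeasurableSet {p : ℝ × ℝ | p.2 ∈ Ioo (0:ℝ) 1 ∧ p.1 ∈ Ioo (0:ℝ) 1 ∧
        moE α β p.2 p.1} := by
      refine MeasurableSet.inter (measurable_snd measurableSet_Ioo)
        (MeasurableSet.inter (measurable_fst measurableSet_Ioo) (MeasurableSet.union ?_ ?_))
      · exact (measurableSet_eq_fun (by fun_prop) (by fun_prop)).compl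
      · exact MeasurableSet.const _
    have h1 : ∀ᵐ p ∂(unif01.prod unif01), p.2 ∈ Ioo (0:ℝ) 1 ∧ p.1 ∈ Ioo (0:ℝ) 1 ∧
        moE α β p.2 p.1 := by
      rw [Measure.ae_prod_iff_ae_ae hms]
      filter_upwards [ae_Ioo] with y hy
      filter_upwards [ae_moE hα hβ hy] with x hx
      exact ⟨hx.1, hy, hx.2⟩
    have h2 := (Measure.measurePreserving_swap (μ := unif01) (ν := unif01)).quasiMeasurePreserving.ae h1
    filter_upwards [h2] with p hp
    exact mo_mixed hα hβ hp.1 hp.2.1 hp.2.2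
  · intro κ hκ hC
    have hval : ∀ y ∈ Ioo (0:ℝ) 1, ∀ᵐ x ∂unif01, κ x (Iic y) = ENNReal.ofReal (moG α β x y) := by
      intro y hy
      filter_upwards [hC y ⟨hy.1.le, hy.2.le⟩, ae_moE hα hβ hy] with x hx hxE
      rw [hx, (mo_deriv hxE.1.1 hy.1 hxE.2).deriv]
    -- invariance
    have hIic : ∀ y ∈ Ioo (0:ℝ) 1, (unif01.bind κ) (Iic y) = ENNReal.ofReal y := by
      intro y hy
      rw [Measure.bind_apply measurableSet_Iic κ.aemeasurable, lintegral_congr_ae (hval y hy),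
        ← ofReal_integral_eq_lintegral_ofReal (integrable_moG hα hβ hy), integral_moG hα hβ hy]
      filter_upwards [ae_Ioo] with x hx
      exact moG_nonneg hβ hx.1 hy.1
    have hIoc : ∀ (ν : Measure ℝ) [IsProbabilityMeasure ν] (a b : ℝ), a < b →
        ν.real (Ioc a b) = ν.real (Iic b) - ν.real (Iic a) := by
      intro ν _ a b hab
      rw [← Iic_sdiff_Iic, measureReal_sdiff (Iic_subset_Iic.2 hab.le) measurableSet_Iic]
    have hinv : unif01.bind κ = unif01 := by
      have hle : ENNReal.ofReal 1 • unif01 ≤ unif01.bind κ := by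
        apply smul_unif_le _ 1 zero_le_one
        intro p q hp hpq hq
        have hp1 := hpq.trans hq
        have hq0 := hp.trans hpq
        rw [hIoc _ _ _ hpq, Measure.real, Measure.real, hIic _ ⟨hq0, hq⟩, hIic _ ⟨hp, hp1⟩,
          ENNReal.toReal_ofReal hq0.le, ENNReal.toReal_ofReal hp.le, one_mul]
      rw [ENNReal.ofReal_one, one_smul] at hle
      exact (Measure.eq_of_le_of_measure_univ_eq hle (by simp)).symm
    have hall : ∀ᵐ x ∂unif01, ∀ q : ℚ, (q:ℝ) ∈ Ioo (0:ℝ) 1 →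
        κ x (Iic (q:ℝ)) = ENNReal.ofReal (moG α β x q) := by
      rw [ae_all_iff]
      intro q
      by_cases hq : (q:ℝ) ∈ Ioo (0:ℝ) 1
      · filter_upwards [hval q hq] with x hx _
        exact hx
      · exact ae_of_all _ fun x h => absurd h hq
    set c := min (1 - α) (1 - β) / 2 with hc
    have hcle : c ≤ min (1 - α) (1 - β) := by linarith
    have hc1 : c < 1 := by
      have := min_le_left (1 - α) (1 - β)
      linarith [hα.1]
    have hcpos : 0 < c := by linarith
    have hminor : ∀ᵐ x ∂unif01, ENNReal.ofReal c • unif01 ≤ κ x := by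
      filter_upwards [hall, ae_Ioo] with x hx hx0
      apply smul_unif_le _ c hcpos.le
      intro p q hp hpq hq
      have hp1 := hpq.trans hq
      have hq0 := hp.trans hpq
      rw [hIoc _ _ _ hpq, Measure.real, Measure.real, hx q ⟨hq0, hq⟩, hx p ⟨hp, hp1⟩,
        ENNReal.toReal_ofReal (moG_nonneg hβ hx0.1 hq0),
        ENNReal.toReal_ofReal (moG_nonneg hβ hx0.1 hp)]
      refine le_trans ?_ (moG_incr hα hβ hx0 hp hpq hq)
      exact mul_le_mul_of_nonneg_right hcle (by linarith)
    refine ⟨1, zero_le_one, 1 - c, ⟨by linarith, by linarith⟩, fun n _ => ?_⟩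
    rw [one_mul]
    exact doeblin κ unif01 hinv c hcpos hc1 hminor n
end
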